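/- Let O be a finite set of objects and acc : Finset O → Finset O a monotone accessibility map (S ⊆ T implies acc S ⊆ acc T). If there exists a full removal sequence, then every removal sequence can be extended to a full removal sequence; in particular, every maximal removal sequence (one that cannot be extended by any accessible object not yet removed) contains all objects of O. Hence the feasibility of a clutter removal instance is independent of the order in which objects are removed. -/

import Mathlib

/-- A removal sequence for the accessibility map `acc`: a list of pairwise
distinct objects such that each object is accessible once the objects
preceding it in the list have been removed. -/
def IsRemovalSeq {O : Type*} [DecidableEq O] (acc : Finset O → Finset O)
    (l : List O) : Prop :=
  l.Nodup ∧ ∀ i : Fin l.length, l.get i ∈ acc (l.take i).toFinset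

theorem IsRemovalSeq.exists_notMem_mem_acc {O : Type*} [DecidableEq O]
    {acc : Finset O → Finset O} (hmono : ∀ S T : Finset O, S ⊆ T → acc S ⊆ acc T)
    {m : List O} (hm : IsRemovalSeq acc m) {S : Finset O} (hS : ¬ m.toFinset ⊆ S) :
    ∃ o, o ∉ S ∧ o ∈ acc S := by
  classical
  have hex : ∃ i, ∃ h : i < m.length, m[i] ∉ S := by
    obtain ⟨x, hx, hxS⟩ := Finset.not_subset.mp hS
    obtain ⟨i, hi, rfl⟩ := List.mem_iff_getElem.mp (List.mem_toFinset.mp hx)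
    exact ⟨i, hi, hxS⟩
  obtain ⟨hi, hiS⟩ := Nat.find_spec hex
  refine ⟨m[Nat.find hex], hiS, hmono _ _ ?_ (hm.2 ⟨Nat.find hex, hi⟩)⟩
  intro x hx
  obtain ⟨j, hj, rfl⟩ := List.mem_iff_getElem.mp (List.mem_toFinset.mp hx)
  rw [List.length_take] at hj
  rw [List.getElem_take]
  by_contra hjS
  exact Nat.find_min hex (lt_of_lt_of_le hj (min_le_left _ _))
    ⟨lt_of_lt_of_le hj (min_le_right _ _), hjS⟩

theorem IsRemovalSeq.append_singleton {O : Type*} [DecidableEq O]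
    {acc : Finset O → Finset O} {l : List O} (hl : IsRemovalSeq acc l) {o : O}
    (ho : o ∉ l.toFinset) (hacc : o ∈ acc l.toFinset) : IsRemovalSeq acc (l ++ [o]) := by
  refine ⟨by simpa using hl.1.concat (by simpa using ho), ?_⟩
  rintro ⟨i, hi⟩
  rw [List.length_append, List.length_singleton] at hi
  rcases Nat.lt_succ_iff_lt_or_eq.mp hi with h | rfl
  · have := hl.2 ⟨i, h⟩
    simpa [List.getElem_append_left h, List.take_append_of_le_length h.le] using this
  · simpa using hacc

theorem IsRemovalSeq.exists_append_full {O : Type*} [Fintype O] [DecidableEq O]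
    {acc : Finset O → Finset O}
    (hstep : ∀ S : Finset O, S ≠ Finset.univ → ∃ o, o ∉ S ∧ o ∈ acc S)
    (l : List O) (hl : IsRemovalSeq acc l) :
    ∃ l' : List O, IsRemovalSeq acc (l ++ l') ∧ (l ++ l').toFinset = Finset.univ := by
  by_cases h : l.toFinset = Finset.univ
  · exact ⟨[], by simpa using hl, by simpa using h⟩
  · obtain ⟨o, ho, hacc⟩ := hstep _ h
    have hlo := hl.append_singleton ho hacc
    have hlen : (l ++ [o]).length ≤ Fintype.card O := hlo.1.length_le_card
    obtain ⟨l', h₁, h₂⟩ := exists_append_full hstep (l ++ [o]) hlo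
    exact ⟨o :: l', by simpa using h₁, by simpa using h₂⟩
termination_by Fintype.card O - l.length
decreasing_by
  simp only [List.length_append, List.length_singleton] at hlen ⊢
  omega

/-- If a monotone accessibility map admits a full removal sequence, then every
removal sequence extends to a full removal sequence; in particular every
maximal removal sequence (one that cannot be extended by any accessible object
not yet removed) contains all objects. -/
theorem every_removal_sequence_extends_to_full
    {O : Type*} [Fintype O] [DecidableEq O]
    (acc : Finset O → Finset O)
    (hmono : ∀ S T : Finset O, S ⊆ T → acc S ⊆ acc T)
    (hfull : ∃ l : List O, IsRemovalSeq acc l ∧ l.toFinset = Finset.univ) :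
    (∀ l : List O, IsRemovalSeq acc l →
      ∃ l' : List O, IsRemovalSeq acc (l ++ l') ∧ (l ++ l').toFinset = Finset.univ) ∧
    (∀ l : List O, IsRemovalSeq acc l →
      (¬ ∃ o, o ∉ l.toFinset ∧ o ∈ acc l.toFinset) → l.toFinset = Finset.univ) := by
  have hstep : ∀ S : Finset O, S ≠ Finset.univ → ∃ o, o ∉ S ∧ o ∈ acc S := by
    intro S hS
    obtain ⟨m, hm, hmu⟩ := hfull
    refine hm.exists_notMem_mem_acc hmono fun h => hS ?_
    rwa [hmu, Finset.univ_subset_iff] at h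
  refine ⟨IsRemovalSeq.exists_append_full hstep, fun l _ hmax => ?_⟩
  by_contra h
  exact hmax (hstep _ h)
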